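/- arXiv:1606.07476 — 2 statements merged into one kernel-verified Lean document; each statement's English description precedes it below -/
import Mathlib

section
/- Let (X,b,m) be a connected weighted graph satisfying (B) and (M), let D ⊂ X be relatively dense, Ω := X∖D ≠ ∅, and let I ⊂ ℝ be an interval with max I < λ_Ω. Then the spectral projection P_I(H) of the weighted Laplacian H satisfies P_I(H) 1_D P_I(H) ≥ ((λ_Ω − max I)² / (16‖H+1‖²(λ_Ω+1)²)) · P_I(H), where 1_D is the operator of multiplication by the indicator function of D. -/
/-! Basic notions for a weighted graph `(X, b, m)`:
`b : X × X → [0,∞)` is a symmetric edge weight, `m : X → (0,∞)` a vertex measure.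
Paths, path lengths, the induced path metric `graphDist`, the energy form,
`ℓ²(X,m)`, volumes, inradius and covering radius. -/

variable {X : Type*}

/-- A path in the weighted graph: a nonempty list of vertices with positive
edge weight between consecutive vertices. -/
def IsPath (b : X → X → ℝ) (γ : List X) : Prop :=
  γ ≠ [] ∧ γ.Chain' fun u v => 0 < b u v

/-- A path from `x` to `y`. -/
def IsPathFrom (b : X → X → ℝ) (γ : List X) (x y : X) : Prop :=
  IsPath b γ ∧ γ.head? = some x ∧ γ.getLast? = some y

/-- The length of a path: the sum of the reciprocals of the edge weights
of its edges. -/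
noncomputable def pathLength (b : X → X → ℝ) : List X → ℝ
  | [] => 0
  | [_] => 0
  | u :: v :: rest => 1 / b u v + pathLength b (v :: rest)

/-- The induced path metric: `d(x,y)` is the infimum of the lengths of paths
from `x` to `y`. -/
noncomputable def graphDist (b : X → X → ℝ) (x y : X) : ℝ :=
  sInf {L | ∃ γ, IsPathFrom b γ x y ∧ L = pathLength b γ}

/-- The energy form `E(f,f) = (1/2) ∑_{x,y} b(x,y) (f(x) - f(y))²`. -/
noncomputable def energy (b : X → X → ℝ) (f : X → ℝ) : ℝ :=
  (1 / 2) * ∑' p : X × X, b p.1 p.2 * (f p.1 - f p.2) ^ 2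

/-- The squared norm in `ℓ²(X,m)`. -/
noncomputable def l2norm (m : X → ℝ) (f : X → ℝ) : ℝ := ∑' x, f x ^ 2 * m x

/-- Membership in `ℓ²(X,m)`. -/
def MemL2 (m : X → ℝ) (f : X → ℝ) : Prop := Summable fun x => f x ^ 2 * m x

/-- The volume of a subset `A ⊆ X`: `vol(A) = ∑_{x ∈ A} m(x)`. -/
noncomputable def vol (m : X → ℝ) (A : Set X) : ℝ := ∑' x : A, m (x : X)

/-- The inradius `Inr(Ω) = sup {r > 0 : ∃ x ∈ Ω, U_r(x) ⊆ Ω}`. -/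
noncomputable def inradius (b : X → X → ℝ) (Ω : Set X) : ℝ :=
  sSup {r | 0 < r ∧ ∃ x ∈ Ω, ∀ y, graphDist b x y < r → y ∈ Ω}

/-- The covering radius `Covr(D) = inf {R > 0 : ⋃_{p ∈ D} B_R(p) = X}`. -/
noncomputable def covRad (b : X → X → ℝ) (D : Set X) : ℝ :=
  sInf {R | 0 < R ∧ ∀ x, ∃ p ∈ D, graphDist b p x ≤ R}

/-- `D` is relatively dense iff its covering radius is finite, i.e. some
`R > 0` works. -/
def RelDense (b : X → X → ℝ) (D : Set X) : Prop :=
  {R : ℝ | 0 < R ∧ ∀ x, ∃ p ∈ D, graphDist b p x ≤ R}.Nonempty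

/-- `vol[s] = sup_{x ∈ X} vol(B_s(x))`. -/
noncomputable def supVolBall (b : X → X → ℝ) (m : X → ℝ) (s : ℝ) : ℝ :=
  ⨆ x : X, vol m {y | graphDist b x y ≤ s}

local notation "⟪" x ", " y "⟫" => @inner ℝ _ _ x y

/-- The energy form, as a bilinear expression:
`E(f,g) = (1/2) ∑_{x,y} b(x,y)(f(x) − f(y))(g(x) − g(y))`. -/
noncomputable def energyBilin (b : X → X → ℝ) (f g : X → ℝ) : ℝ :=
  (1 / 2) * ∑' p : X × X, b p.1 p.2 * (f p.1 - f p.2) * (g p.1 - g p.2)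

/-- The bottom `λ_Ω` of the spectrum of the Dirichlet Laplacian `H_Ω` on
`Ω = X∖D`, via its variational characterization: the infimum of the Rayleigh
quotients `E(f,f)/‖f‖²` over nonzero `f ∈ ℓ²(X,m)` vanishing on `D`. -/
noncomputable def dirichletLambda (b : X → X → ℝ) (m : X → ℝ) (D : Set X) : ℝ :=
  sInf {r | ∃ f : X → ℝ, MemL2 m f ∧ f ≠ 0 ∧ (∀ x ∈ D, f x = 0) ∧
    r = energy b f / l2norm m f}

/-- Theorem 5.1, the main theorem. Let `(X,b,m)` be a
connected weighted graph satisfying (B) and (M), `D ⊆ X` relatively dense,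
`Ω := X∖D ≠ ∅`, and `I ⊆ ℝ` an interval with `max I < λ_Ω`. Then
`P_I(H) 1_D P_I(H) ≥ κ P_I(H)` with
`κ = (λ_Ω − max I)²/(16 ‖H+1‖² (λ_Ω+1)²)`; equivalently (the form stated
here), `κ‖φ‖² ≤ ⟨1_D φ, φ⟩` for every `φ` in the range of `P_I(H)`. -/
theorem statement_15 {X : Type*} [Countable X] [Nonempty X]
    (b : X → X → ℝ) (m : X → ℝ)
    (hb_symm : ∀ x y, b x y = b y x) (hb_nonneg : ∀ x y, 0 ≤ b x y)
    (hb_diag : ∀ x, b x x = 0) (hb_sum : ∀ x, Summable fun y => b x y)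
    (hm_pos : ∀ x, 0 < m x)
    (hconn : ∀ x y, ∃ γ, IsPathFrom b γ x y)
    (hB : BddAbove (Set.range fun x => (∑' y, b x y) / m x))
    (hM : BddAbove (Set.range m))
    (D : Set X) (hD : RelDense b D) (hΩne : (Dᶜ : Set X).Nonempty)
    -- the Hilbert space `𝓗 = ℓ²(X,m)`, realized via an isomorphism `J`
    -- onto the square-summable functions, carrying the `ℓ²(X,m)` inner product:
    {𝓗 : Type*} [NormedAddCommGroup 𝓗] [InnerProductSpace ℝ 𝓗] [CompleteSpace 𝓗]
    (J : 𝓗 →ₗ[ℝ] (X → ℝ))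
    (hJ_inj : Function.Injective J)
    (hJ_mem : ∀ u, MemL2 m (J u))
    (hJ_surj : ∀ f : X → ℝ, MemL2 m f → ∃ u, J u = f)
    (hJ_inner : ∀ u v : 𝓗, ⟪u, v⟫ = ∑' x, J u x * J v x * m x)
    -- the weighted Laplacian `H`, i.e. the bounded self-adjoint operator
    -- associated with the energy form:
    (H : 𝓗 →L[ℝ] 𝓗)
    (hH : ∀ u v : 𝓗, ⟪H u, v⟫ = energyBilin b (J u) (J v))
    -- the multiplication operator `1_D`:
    (W : 𝓗 →L[ℝ] 𝓗)
    (hW : ∀ u : 𝓗, J (W u) = D.indicator (J u))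
    -- the interval `I`, bounded above, with maximum `sSup I ∈ I`:
    (I : Set ℝ) (hI_ne : I.Nonempty) (hI_interval : I.OrdConnected)
    (hI_bdd : BddAbove I) (hI_max : sSup I ∈ I)
    (hI_max_lt : sSup I < dirichletLambda b m D)
    -- the spectral projection `P = P_I(H)`: an orthogonal projection such
    -- that `⟨Hφ,φ⟩ ≤ max I ‖φ‖²` on its range (as `I ⊆ (-∞, max I]`):
    (P : 𝓗 →L[ℝ] 𝓗)
    (hP_idem : P ∘L P = P)
    (hP_sa : ∀ u v : 𝓗, ⟪P u, v⟫ = ⟪u, P v⟫)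
    (hP_spec : ∀ u : 𝓗, ⟪H (P u), P u⟫ ≤ sSup I * ‖P u‖ ^ 2) :
    ∀ φ : 𝓗,
      ((dirichletLambda b m D - sSup I) ^ 2 /
          (16 * ‖H + 1‖ ^ 2 * (dirichletLambda b m D + 1) ^ 2)) * ‖P φ‖ ^ 2 ≤
        ⟪W (P φ), P φ⟫ := by
  intro φ
  have hE0 : ∀ u : 𝓗, 0 ≤ ⟪H u, u⟫ := by
    intro u
    rw [hH]
    unfold energyBilin
    refine mul_nonneg (by norm_num) (tsum_nonneg fun p => ?_)
    rw [mul_assoc]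
    exact mul_nonneg (hb_nonneg _ _) (mul_self_nonneg _)
  have hEe : ∀ u : 𝓗, ⟪H u, u⟫ = energy b (J u) := by
    intro u
    rw [hH]
    unfold energyBilin energy
    congr 1
    refine tsum_congr fun p => ?_
    ring
  have hN : ∀ u : 𝓗, l2norm m (J u) = ‖u‖ ^ 2 := by
    intro u
    rw [← real_inner_self_eq_norm_sq, hJ_inner]
    unfold l2norm
    refine tsum_congr fun p => ?_
    ring
  have hmu := hP_spec φ
  generalize P φ = u at hmu ⊢
  set mu := sSup I with hmu_def
  set lam := dirichletLambda b m D with hlam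
  set K := ‖H + 1‖ with hK
  have hlamv : ∀ v : 𝓗, v ≠ 0 → (∀ x ∈ D, J v x = 0) → lam * ‖v‖ ^ 2 ≤ ⟪H v, v⟫ := by
    intro v hv hvD
    have hvpos : 0 < ‖v‖ ^ 2 := by positivity
    have hle : lam ≤ energy b (J v) / l2norm m (J v) := by
      refine csInf_le ⟨0, ?_⟩ ⟨J v, hJ_mem v, ?_, hvD, rfl⟩
      · rintro r ⟨f, -, -, -, rfl⟩
        refine div_nonneg ?_ ?_
        · unfold energy
          exact mul_nonneg (by norm_num)
            (tsum_nonneg fun p => mul_nonneg (hb_nonneg _ _) (sq_nonneg _))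
        · exact tsum_nonneg fun x => mul_nonneg (sq_nonneg _) (hm_pos x).le
      · intro h0
        exact hv (hJ_inj (by rw [h0, map_zero]))
    rw [hN, ← hEe, le_div_iff₀ hvpos] at hle
    exact hle
  have hwu : ⟪W u, u⟫ = ‖W u‖ ^ 2 := by
    rw [← real_inner_self_eq_norm_sq, hJ_inner, hJ_inner]
    refine tsum_congr fun x => ?_
    rw [hW]
    by_cases hx : x ∈ D <;> simp [hx]
  by_cases hu : u = 0
  · subst hu; simp
  have hupos : 0 < ‖u‖ := norm_pos_iff.mpr hu
  have hmu0 : 0 ≤ mu := by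
    have := (hE0 u).trans hmu
    exact nonneg_of_mul_nonneg_left this (by positivity)
  have hKq : ∀ x y : 𝓗, ⟪(H + 1) x, y⟫ ≤ K * ‖x‖ * ‖y‖ := fun x y =>
    (real_inner_le_norm _ _).trans
      (mul_le_mul_of_nonneg_right ((H + 1).le_opNorm x) (norm_nonneg _))
  have hKq' : ∀ x y : 𝓗, -⟪(H + 1) x, y⟫ ≤ K * ‖x‖ * ‖y‖ := fun x y => by
    have := hKq x (-y)
    rwa [inner_neg_right, norm_neg] at this
  have hq : ∀ x : 𝓗, ⟪(H + 1) x, x⟫ = ⟪H x, x⟫ + ‖x‖ ^ 2 := by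
    intro x
    rw [← real_inner_self_eq_norm_sq, ← inner_add_left]
    rfl
  have hK1 : 1 ≤ K := by
    have h1 := hKq u u
    rw [hq] at h1
    have h2 := hE0 u
    have h3 : 0 < ‖u‖ ^ 2 := by positivity
    nlinarith
  rw [hwu]
  have key : (lam - mu) * ‖u‖ ≤ 4 * K * (lam + 1) * ‖W u‖ := by
    have hsplit : ‖u‖ ^ 2 = ‖u - W u‖ ^ 2 + ‖W u‖ ^ 2 := by
      have := @norm_sub_sq_real 𝓗 _ _ u (W u)
      rw [real_inner_comm, hwu] at this
      linarith
    by_cases hv : u - W u = 0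
    · have : W u = u := (sub_eq_zero.mp hv).symm
      rw [this]
      refine mul_le_mul_of_nonneg_right ?_ hupos.le
      nlinarith
    have hvpos : 0 < ‖u - W u‖ ^ 2 := by positivity
    have h1 := hlamv _ hv (by
      intro x hx
      rw [map_sub, Pi.sub_apply, hW]
      simp [hx])
    have h2 := hKq (u - W u) (u - W u)
    rw [hq] at h2
    have hlK : lam + 1 ≤ K := by
      by_contra hc
      nlinarith
    have h3 : ⟪(H + 1) (u - W u), u - W u⟫ = ⟪(H + 1) u, u⟫ - ⟪(H + 1) u, W u⟫
        - ⟪(H + 1) (W u), u⟫ + ⟪(H + 1) (W u), W u⟫ := by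
      rw [map_sub, inner_sub_left, inner_sub_right, inner_sub_right]; ring
    have h4 := hKq' u (W u)
    have h5 := hKq' (W u) u
    have h6 := hKq (W u) (W u)
    rw [hq, hq] at h3
    have hc0 := norm_nonneg (W u)
    have hca : ‖W u‖ ≤ ‖u‖ := by nlinarith
    have h7 : (lam - mu) * ‖u‖ ^ 2 ≤ 2 * K * ‖u‖ * ‖W u‖ + 2 * K * ‖W u‖ ^ 2 := by
      have h8 : (lam + 1) * ‖W u‖ ^ 2 ≤ K * ‖W u‖ ^ 2 :=
        mul_le_mul_of_nonneg_right hlK (sq_nonneg _)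
      have h9 : ‖u - W u‖ ^ 2 = ‖u‖ ^ 2 - ‖W u‖ ^ 2 := by linarith
      rw [h9] at h1 h3
      nlinarith
    have h8 : 2 * K * ‖W u‖ ^ 2 ≤ 2 * K * ‖u‖ * ‖W u‖ := by
      have : ‖W u‖ * ‖W u‖ ≤ ‖u‖ * ‖W u‖ := mul_le_mul_of_nonneg_right hca hc0
      nlinarith
    have h9 : ((lam - mu) * ‖u‖) * ‖u‖ ≤ (4 * K * ‖W u‖) * ‖u‖ := by nlinarith
    have h10 := le_of_mul_le_mul_right h9 hupos
    have h11 : 0 ≤ K * ‖W u‖ * lam := by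
      have : 0 ≤ lam := by linarith
      positivity
    nlinarith
  have hl : 0 < lam + 1 := by linarith
  have hden : 0 < 16 * K ^ 2 * (lam + 1) ^ 2 := by positivity
  rw [div_mul_eq_mul_div, div_le_iff₀ hden]
  have hpos : 0 ≤ (lam - mu) * ‖u‖ := mul_nonneg (by linarith) hupos.le
  have := pow_le_pow_left₀ hpos key 2
  nlinarith
end

section
/- Let (X,b,m) be a connected weighted graph satisfying (B) and (M), let D ⊂ X be relatively dense, Ω := X∖D ≠ ∅, and let I ⊂ ℝ be an interval with max I < 1/(Inr(Ω)·vol[Inr(Ω)]). Then the spectral projection P_I(H) of the weighted Laplacian H satisfies P_I(H) 1_D P_I(H) ≥ ((1/(Inr(Ω)·vol[Inr(Ω)]) − max I)² / (16‖H+1‖⁴)) · P_I(H). -/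
/-! Basic notions for a weighted graph `(X, b, m)`:
`b : X × X → [0,∞)` is a symmetric edge weight, `m : X → (0,∞)` a vertex measure.
Paths, path lengths, the induced path metric `graphDist`, the energy form,
`ℓ²(X,m)`, volumes, inradius and covering radius. -/

variable {X : Type*}

local notation "⟪" x ", " y "⟫" => @inner ℝ _ _ x y

/-! ### Paths -/

lemma wg_path_cons {b : X → X → ℝ} {x y z : X} {γ : List X} (h : IsPathFrom b γ y z)
    (hxy : 0 < b x y) :
    IsPathFrom b (x :: γ) x z ∧ pathLength b (x :: γ) = 1 / b x y + pathLength b γ := by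
  cases γ with
  | nil => exact absurd rfl h.1.1
  | cons u t =>
    obtain ⟨⟨_, hc⟩, hh, hl⟩ := h
    simp only [List.head?_cons, Option.some.injEq] at hh
    subst hh
    refine ⟨⟨⟨by simp, ?_⟩, by simp, ?_⟩, ?_⟩
    · exact List.isChain_cons_cons.2 ⟨hxy, hc⟩
    · rw [List.getLast?_cons_cons]; exact hl
    · simp [pathLength]

lemma wg_path_uncons {b : X → X → ℝ} {x z : X} {γ : List X} (h : IsPathFrom b γ x z) :
    (γ = [x] ∧ x = z) ∨ ∃ y γ', γ = x :: γ' ∧ IsPathFrom b γ' y z ∧ 0 < b x y ∧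
      pathLength b γ = 1 / b x y + pathLength b γ' := by
  obtain ⟨⟨hne, hc⟩, hh, hl⟩ := h
  match γ, hne, hc, hh, hl with
  | [u], _, _, hh, hl =>
    left
    simp at hh hl
    exact ⟨by rw [hh], by rw [← hh, hl]⟩
  | u :: v :: t, _, hc, hh, hl =>
    right
    simp only [List.head?_cons, Option.some.injEq] at hh
    subst hh
    have hc' := List.isChain_cons_cons.1 hc
    refine ⟨v, v :: t, rfl, ⟨⟨by simp, hc'.2⟩, by simp, ?_⟩, hc'.1, by simp [pathLength]⟩
    rw [List.getLast?_cons_cons] at hl; exact hl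

lemma wg_path_single (b : X → X → ℝ) (x : X) : IsPathFrom b [x] x x :=
  ⟨⟨by simp, by simp [List.Chain']⟩, by simp, by simp⟩

lemma wg_path_snoc {b : X → X → ℝ} {y z : X} (hyz : 0 < b y z) :
    ∀ (γ : List X) (x : X), IsPathFrom b γ x y →
    ∃ γ', IsPathFrom b γ' x z ∧ pathLength b γ' = pathLength b γ + 1 / b y z := by
  intro γ
  induction γ with
  | nil => intro x h; exact absurd rfl h.1.1
  | cons u t ih =>
    intro x h
    rcases wg_path_uncons h with ⟨h1, h2⟩ | ⟨w, γ', h1, h2, h3, h4⟩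
    · subst h2
      have := wg_path_cons (wg_path_single b z) hyz
      refine ⟨_, this.1, ?_⟩
      rw [this.2, h1]; simp [pathLength]
    · have h5 : t = γ' := (List.cons.inj h1).2
      subst h5
      obtain ⟨γ', h6, h7⟩ := ih w h2
      have := wg_path_cons h6 h3
      refine ⟨_, this.1, ?_⟩
      rw [this.2, h4, h7]; ring

lemma wg_pathLength_nonneg {b : X → X → ℝ} (hb : ∀ x y, 0 ≤ b x y) :
    ∀ γ : List X, 0 ≤ pathLength b γ
  | [] => le_refl _
  | [_] => le_refl _
  | u :: v :: t => by
    have := wg_pathLength_nonneg hb (v :: t)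
    have h2 := hb u v
    simp only [pathLength]
    positivity

lemma wg_dist_le {b : X → X → ℝ} (hb : ∀ x y, 0 ≤ b x y) {x y : X} {γ : List X}
    (h : IsPathFrom b γ x y) : graphDist b x y ≤ pathLength b γ := by
  apply csInf_le
  · refine ⟨0, ?_⟩
    rintro L ⟨γ, _, rfl⟩
    exact wg_pathLength_nonneg hb γ
  · exact ⟨γ, h, rfl⟩

lemma wg_exists_path {b : X → X → ℝ} {x y : X} (hc : ∃ γ, IsPathFrom b γ x y) {r : ℝ}
    (h : graphDist b x y < r) : ∃ γ, IsPathFrom b γ x y ∧ pathLength b γ < r := by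
  obtain ⟨γ, hγ⟩ := hc
  obtain ⟨L, ⟨γ, h1, rfl⟩, h2⟩ := exists_lt_of_csInf_lt (s := {L | ∃ γ, IsPathFrom b γ x y ∧ L = pathLength b γ}) ⟨_, γ, hγ, rfl⟩ h
  exact ⟨γ, h1, h2⟩

/-- Finitely many paths of bounded length from a vertex. -/
lemma wg_finite_paths {b : X → X → ℝ} (hb : ∀ x y, 0 ≤ b x y)
    (hs : ∀ x, Summable fun y => b x y) {c : ℝ} (hc : 0 < c)
    (hbc : ∀ x y, 0 < b x y → c ≤ 1 / b x y) (n : ℕ) :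
    ∀ (x : X) (L : ℝ), L < n * c → {γ | (∃ z, IsPathFrom b γ x z) ∧ pathLength b γ ≤ L}.Finite := by
  induction n with
  | zero =>
    intro x L hL
    apply Set.Finite.subset Set.finite_empty
    rintro γ ⟨_, h⟩
    have := wg_pathLength_nonneg hb γ
    simp at hL
    linarith
  | succ n ih =>
    intro x L hL
    have hfin : {y | 0 < b x y ∧ 1 / b x y ≤ L}.Finite := by
      by_cases hL0 : 0 < L
      · have h1 := (hs x).tendsto_cofinite_zero
        have h2 := h1.eventually (gt_mem_nhds (show (0:ℝ) < 1 / L by positivity))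
        rw [Filter.eventually_cofinite] at h2
        refine h2.subset ?_
        rintro y ⟨h3, h4⟩
        simp only [Set.mem_setOf_eq, not_lt]
        rw [div_le_iff₀ h3] at h4
        rw [div_le_iff₀ hL0]; linarith
      · apply Set.Finite.subset Set.finite_empty
        rintro y ⟨h3, h4⟩
        have : 0 < 1 / b x y := by positivity
        linarith
    have hU : (⋃ y ∈ {y | 0 < b x y ∧ 1 / b x y ≤ L},
      (fun γ => x :: γ) '' {γ | (∃ z, IsPathFrom b γ y z) ∧ pathLength b γ ≤ L - c}).Finite := by
      apply hfin.biUnion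
      intro y _
      apply Set.Finite.image
      apply ih
      push_cast at hL
      linarith
    refine (hU.union (Set.finite_singleton [x])).subset ?_
    rintro γ ⟨⟨z, hz⟩, hl⟩
    rcases wg_path_uncons hz with ⟨h1, h2⟩ | ⟨y, γ', h1, h2, h3, h4⟩
    · right; exact h1
    · left
      have h5 := wg_pathLength_nonneg hb γ'
      have h6 := hbc x y h3
      simp only [Set.mem_iUnion, Set.mem_image]
      exact ⟨y, ⟨h3, by linarith⟩, γ', ⟨⟨z, h2⟩, by linarith⟩, h1.symm⟩

lemma wg_finite_paths' {b : X → X → ℝ} (hb : ∀ x y, 0 ≤ b x y)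
    (hs : ∀ x, Summable fun y => b x y) {c : ℝ} (hc : 0 < c)
    (hbc : ∀ x y, 0 < b x y → c ≤ 1 / b x y) (x : X) (L : ℝ) :
    {γ | (∃ z, IsPathFrom b γ x z) ∧ pathLength b γ ≤ L}.Finite := by
  obtain ⟨n, hn⟩ := exists_nat_gt (L / c)
  exact wg_finite_paths hb hs hc hbc n x L (by rwa [div_lt_iff₀ hc] at hn)

lemma wg_finite_ball {b : X → X → ℝ} (hb : ∀ x y, 0 ≤ b x y)
    (hs : ∀ x, Summable fun y => b x y) {c : ℝ} (hc : 0 < c)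
    (hbc : ∀ x y, 0 < b x y → c ≤ 1 / b x y)
    (hconn : ∀ x y, ∃ γ, IsPathFrom b γ x y) (x : X) (s : ℝ) :
    {y | graphDist b x y ≤ s}.Finite := by
  have h1 := wg_finite_paths' hb hs hc hbc x (s + 1)
  have h2 := h1.image (fun γ => γ.getLast?)
  refine Set.Finite.of_finite_image (f := some) (h2.subset ?_) (Option.some_injective _).injOn
  rintro _ ⟨y, hy, rfl⟩
  obtain ⟨γ, h3, h4⟩ := wg_exists_path (hconn x y) (r := s + 1) (by simp at hy; linarith)
  exact ⟨γ, ⟨⟨y, h3⟩, h4.le⟩, h3.2.2⟩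

/-- The distance to `D` together with a parent map. -/
lemma wg_parent {b : X → X → ℝ} (hb : ∀ x y, 0 ≤ b x y)
    (hs : ∀ x, Summable fun y => b x y) {c : ℝ} (hc : 0 < c)
    (hbc : ∀ x y, 0 < b x y → c ≤ 1 / b x y)
    (hconn : ∀ x y, ∃ γ, IsPathFrom b γ x y) (D : Set X) (hD : D.Nonempty) :
    ∃ (ρ : X → ℝ) (π : X → X), (∀ x, 0 ≤ ρ x) ∧ (∀ x ∈ D, π x = x) ∧
      (∀ x, x ∉ D → 0 < b x (π x) ∧ 1 / b x (π x) + ρ (π x) ≤ ρ x) ∧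
      (∀ x, ∀ p ∈ D, ∀ γ, IsPathFrom b γ x p → ρ x ≤ pathLength b γ) := by
  have hmin : ∀ x, ∃ γ, (∃ p ∈ D, IsPathFrom b γ x p) ∧
      ∀ γ', (∃ p ∈ D, IsPathFrom b γ' x p) → pathLength b γ ≤ pathLength b γ' := by
    intro x
    obtain ⟨p, hp⟩ := hD
    obtain ⟨γ0, h0⟩ := hconn x p
    have hfin : {γ | (∃ p ∈ D, IsPathFrom b γ x p) ∧ pathLength b γ ≤ pathLength b γ0}.Finite := by
      refine (wg_finite_paths' hb hs hc hbc x (pathLength b γ0)).subset ?_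
      rintro γ ⟨⟨p, _, h⟩, h2⟩
      exact ⟨⟨p, h⟩, h2⟩
    obtain ⟨γ, h1, h2⟩ := Set.exists_min_image _ (pathLength b) hfin ⟨γ0, ⟨p, hp, h0⟩, le_refl _⟩
    refine ⟨γ, h1.1, fun γ' h' => ?_⟩
    by_cases h3 : pathLength b γ' ≤ pathLength b γ0
    · exact h2 γ' ⟨h', h3⟩
    · linarith [h1.2]
  choose g hg hgmin using hmin
  have hpar : ∀ x, ∃ y, (x ∈ D → y = x) ∧
      (x ∉ D → 0 < b x y ∧ 1 / b x y + pathLength b (g y) ≤ pathLength b (g x)) := by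
    intro x
    by_cases hx : x ∈ D
    · exact ⟨x, fun _ => rfl, fun h => absurd hx h⟩
    · obtain ⟨p, hp, h⟩ := hg x
      rcases wg_path_uncons h with ⟨h1, h2⟩ | ⟨y, γ', h1, h2, h3, h4⟩
      · exact absurd (h2 ▸ hp) hx
      · exact ⟨y, fun h => absurd h hx, fun _ => ⟨h3, by linarith [hgmin y γ' ⟨p, hp, h2⟩]⟩⟩
  choose π hπ1 hπ2 using hpar
  exact ⟨fun x => pathLength b (g x), π, fun x => wg_pathLength_nonneg hb _, hπ1, hπ2,
    fun x p hp γ h => hgmin x γ ⟨p, hp, h⟩⟩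

lemma wg_cs {l ρ a q S : ℝ} (hl : 0 < l) (hρ : 0 ≤ ρ) (hS : 0 ≤ S) (hq : q ^ 2 ≤ ρ * S) :
    (a + q) ^ 2 ≤ (l + ρ) * (a ^ 2 / l + S) := by
  set e := a ^ 2 / l with he
  have he0 : 0 ≤ e := by positivity
  have ha : a ^ 2 = l * e := by rw [he]; field_simp
  have h1 : (2 * (a * q)) ^ 2 ≤ (l * S + ρ * e) ^ 2 := by
    have : a ^ 2 * q ^ 2 ≤ (l * e) * (ρ * S) := by
      rw [ha]; exact mul_le_mul_of_nonneg_left hq (by positivity)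
    nlinarith [sq_nonneg (l * S - ρ * e)]
  have h2 := abs_le_of_sq_le_sq h1 (by positivity)
  nlinarith [(abs_le.1 h2).2]

lemma wg_summable_energy {b : X → X → ℝ} {m : X → ℝ}
    (hsymm : ∀ x y, b x y = b y x) (hb : ∀ x y, 0 ≤ b x y)
    (hs : ∀ x, Summable fun y => b x y) (hm : ∀ x, 0 < m x)
    (hB : BddAbove (Set.range fun x => (∑' y, b x y) / m x))
    {f : X → ℝ} (hf : MemL2 m f) :
    Summable fun p : X × X => b p.1 p.2 * (f p.1 - f p.2) * (f p.1 - f p.2) := by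
  obtain ⟨δ, hδ⟩ := hB
  have h1 : Summable fun p : X × X => b p.1 p.2 * f p.1 ^ 2 := by
    have hnn : ∀ x y, 0 ≤ b x y * f x ^ 2 := fun x y => mul_nonneg (hb x y) (sq_nonneg (f x))
    refine (summable_prod_of_nonneg (fun p => hnn p.1 p.2)).2
      ⟨fun x => Summable.mul_right (f x ^ 2) (hs x), ?_⟩
    have hf' : Summable fun x => δ * (f x ^ 2 * m x) := Summable.mul_left δ hf
    refine Summable.of_nonneg_of_le (fun x => tsum_nonneg fun y => hnn x y) (fun x => ?_) hf'
    have h2 : (∑' y, b x y) / m x ≤ δ := hδ ⟨x, rfl⟩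
    rw [div_le_iff₀ (hm x)] at h2
    simp only
    rw [tsum_mul_right]
    nlinarith [mul_le_mul_of_nonneg_right h2 (sq_nonneg (f x))]
  have h2 : Summable fun p : X × X => b p.1 p.2 * f p.2 ^ 2 := by
    have := (Equiv.prodComm X X).summable_iff.2 h1
    refine this.congr ?_
    rintro ⟨x, y⟩
    simp [hsymm x y]
  refine Summable.of_nonneg_of_le (fun p => ?_) (fun p => ?_) ((h1.add h2).mul_left 2)
  · rw [mul_assoc]; exact mul_nonneg (hb _ _) (mul_self_nonneg _)
  · nlinarith [mul_nonneg (hb p.1 p.2) (sq_nonneg (f p.1 + f p.2))]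

/-- The Poincare inequality on functions vanishing on `D`. -/
lemma wg_poincare {b : X → X → ℝ} {m : X → ℝ}
    (hsymm : ∀ x y, b x y = b y x) (hb : ∀ x y, 0 ≤ b x y)
    (hs : ∀ x, Summable fun y => b x y) (hm : ∀ x, 0 < m x)
    (hconn : ∀ x y, ∃ γ, IsPathFrom b γ x y)
    (hB : BddAbove (Set.range fun x => (∑' y, b x y) / m x))
    (hM : BddAbove (Set.range m))
    (D : Set X) (hD : D.Nonempty)
    (hpos : 0 < inradius b Dᶜ * supVolBall b m (inradius b Dᶜ))
    {f : X → ℝ} (hf : MemL2 m f) (hfD : ∀ x ∈ D, f x = 0) :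
    ∑' x, f x * f x * m x ≤
      inradius b Dᶜ * supVolBall b m (inradius b Dᶜ) * energyBilin b f f := by
  classical
  -- uniform lower bound on the edge lengths
  obtain ⟨c, hc, hbc⟩ : ∃ c : ℝ, 0 < c ∧ ∀ x y, 0 < b x y → c ≤ 1 / b x y := by
    obtain ⟨δ, hδ⟩ := hB
    obtain ⟨M, hM⟩ := hM
    refine ⟨1 / (|δ| * |M| + 1), by positivity, fun x y hxy => ?_⟩
    apply one_div_le_one_div_of_le hxy
    have h1 : b x y ≤ ∑' y, b x y := (hs x).le_tsum y (fun z _ => hb x z)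
    have h2 : (∑' y, b x y) / m x ≤ δ := hδ ⟨x, rfl⟩
    rw [div_le_iff₀ (hm x)] at h2
    have h3 : m x ≤ M := hM ⟨x, rfl⟩
    have h4 : δ * m x ≤ |δ| * |M| :=
      mul_le_mul (le_abs_self _) (h3.trans (le_abs_self _)) (hm x).le (abs_nonneg _)
    linarith
  set r := inradius b Dᶜ with hr
  set V := supVolBall b m r with hV
  have hr0 : 0 ≤ r := Real.sSup_nonneg fun s hs => hs.1.le
  have hr1 : r ≠ 0 := by rintro h; simp [h] at hpos
  have hV1 : V ≠ 0 := by rintro h; simp [h] at hpos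
  have hbdd : BddAbove {s | 0 < s ∧ ∃ x ∈ Dᶜ, ∀ y, graphDist b x y < s → y ∈ Dᶜ} := by
    by_contra h
    exact hr1 (Real.sSup_of_not_bddAbove h)
  have hbddV : BddAbove (Set.range fun x : X => vol m {y | graphDist b x y ≤ r}) := by
    by_contra h
    exact hV1 (Real.iSup_of_not_bddAbove h)
  obtain ⟨ρ, π, hρ0, hπD, hπ, hρmin⟩ := wg_parent hb hs hc hbc hconn D hD
  have hρr : ∀ x, ρ x ≤ r := by
    intro x
    by_cases hx : x ∈ D
    · have := hρmin x x hx _ (wg_path_single b x)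
      simp [pathLength] at this
      linarith
    · have hρx : 0 < ρ x := by
        obtain ⟨h1, h2⟩ := hπ x hx
        have h3 := hρ0 (π x)
        have : 0 < 1 / b x (π x) := by positivity
        linarith
      apply le_csSup hbdd
      refine ⟨hρx, x, hx, fun y hy hyD => ?_⟩
      obtain ⟨γ, h1, h2⟩ := wg_exists_path (hconn x y) hy
      have := hρmin x y hyD γ h1
      linarith
  -- induction principle
  have hind : ∀ Q : X → Prop, (∀ x ∈ D, Q x) → (∀ x, x ∉ D → Q (π x) → Q x) → ∀ x, Q x := by
    intro Q h1 h2
    have : ∀ n : ℕ, ∀ x, ρ x < n * c → Q x := by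
      intro n
      induction n with
      | zero => intro x hx; have := hρ0 x; simp at hx; linarith
      | succ n ih =>
        intro x hx
        by_cases hxD : x ∈ D
        · exact h1 x hxD
        · refine h2 x hxD (ih _ ?_)
          obtain ⟨h3, h4⟩ := hπ x hxD
          have := hbc _ _ h3
          push_cast at hx
          linarith
    intro x
    obtain ⟨n, hn⟩ := exists_nat_gt (ρ x / c)
    exact this n x (by rwa [div_lt_iff₀ hc] at hn)
  -- roots
  have hroot : ∀ x, ∃ p, p ∈ D ∧ (∃ n : ℕ, π^[n] x = p) ∧
      ∃ γ, IsPathFrom b γ p x ∧ pathLength b γ ≤ ρ x := by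
    apply hind
    · intro x hx
      exact ⟨x, hx, ⟨0, rfl⟩, [x], wg_path_single b x, hρ0 x⟩
    · rintro x hx ⟨p, hp, ⟨n, hn⟩, γ, hγ, hl⟩
      obtain ⟨h3, h4⟩ := hπ x hx
      rw [hsymm] at h3
      obtain ⟨γ', h5, h6⟩ := wg_path_snoc h3 γ p hγ
      refine ⟨p, hp, ⟨n + 1, hn⟩, γ', h5, ?_⟩
      rw [h6, hsymm]; linarith
  choose root hrD hrn hrp using hroot
  have hfix : ∀ p ∈ D, ∀ n : ℕ, π^[n] p = p := fun p hp n =>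
    Function.iterate_fixed (hπD p hp) n
  have huniq : ∀ x (n k : ℕ), π^[n] x ∈ D → π^[k] x ∈ D → π^[n] x = π^[k] x := by
    intro x n k h1 h2
    rw [← hfix _ h1 k, ← hfix _ h2 n, ← Function.iterate_add_apply, ← Function.iterate_add_apply,
      add_comm]
  have hrπ : ∀ x, root (π x) = root x := by
    intro x
    obtain ⟨n, hn⟩ := hrn (π x)
    obtain ⟨k, hk⟩ := hrn x
    have hn' : π^[n + 1] x = root (π x) := hn
    have := huniq x (n + 1) k (by rw [hn']; exact hrD _) (by rw [hk]; exact hrD _)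
    rw [← hn', ← hk, this]
  have hrdist : ∀ x, graphDist b (root x) x ≤ r := by
    intro x
    obtain ⟨γ, h1, h2⟩ := hrp x
    exact (wg_dist_le hb h1).trans (h2.trans (hρr x))
  -- chains
  let e : X → ℝ := fun y => b y (π y) * (f y - f (π y)) * (f y - f (π y))
  have he0 : ∀ y, 0 ≤ e y := fun y => by
    simp only [e]; rw [mul_assoc]; exact mul_nonneg (hb _ _) (mul_self_nonneg _)
  have hchain : ∀ x, ∃ A : Finset X, (∀ y ∈ A, y ∉ D ∧ root y = root x ∧ ρ y ≤ ρ x) ∧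
      f x ^ 2 ≤ ρ x * ∑ y ∈ A, e y := by
    apply hind
    · intro x hx
      exact ⟨∅, by simp, by simp [hfD x hx]⟩
    · rintro x hx ⟨A, hA, hfA⟩
      obtain ⟨h3, h4⟩ := hπ x hx
      have hl : 0 < 1 / b x (π x) := by positivity
      have hxA : x ∉ A := fun h => by have := (hA x h).2.2; linarith
      refine ⟨insert x A, ?_, ?_⟩
      · intro y hy
        rcases Finset.mem_insert.1 hy with rfl | hy
        · exact ⟨hx, rfl, le_refl _⟩
        · obtain ⟨h5, h6, h7⟩ := hA y hy
          exact ⟨h5, h6.trans (hrπ x), by linarith⟩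
      · rw [Finset.sum_insert hxA]
        have hS : 0 ≤ ∑ y ∈ A, e y := Finset.sum_nonneg fun y _ => he0 y
        have h8 := wg_cs (a := f x - f (π x)) hl (hρ0 (π x)) hS hfA
        have h9 : (f x - f (π x)) ^ 2 / (1 / b x (π x)) = e x := by
          simp only [e]; field_simp
        rw [h9, sub_add_cancel] at h8
        exact h8.trans (mul_le_mul_of_nonneg_right h4 (add_nonneg (he0 x) hS))
  choose A hA hfA using hchain
  have hsumE := wg_summable_energy hsymm hb hs hm hB hf
  have hterm : ∀ p : X × X, 0 ≤ b p.1 p.2 * (f p.1 - f p.2) * (f p.1 - f p.2) := fun p => by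
    rw [mul_assoc]; exact mul_nonneg (hb _ _) (mul_self_nonneg _)
  -- energy bound
  have hE : ∀ G : Finset X, (∀ y ∈ G, y ∉ D) → ∑ y ∈ G, e y ≤ energyBilin b f f := by
    intro G hG
    have hlt : ∀ y ∈ G, ρ (π y) < ρ y := by
      intro y hy
      obtain ⟨h3, h4⟩ := hπ y (hG y hy)
      have hl : 0 < 1 / b y (π y) := by positivity
      linarith
    have i1 : Set.InjOn (fun y => (y, π y)) (G : Set X) := fun y _ z _ h => (Prod.ext_iff.1 h).1
    have i2 : Set.InjOn (fun y => (π y, y)) (G : Set X) := fun y _ z _ h => (Prod.ext_iff.1 h).2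
    have hdisj : Disjoint (G.image fun y => (y, π y)) (G.image fun y => (π y, y)) := by
      rw [Finset.disjoint_left]
      rintro ⟨u, v⟩ h1 h2
      obtain ⟨y, hy, h1⟩ := Finset.mem_image.1 h1
      obtain ⟨z, hz, h2⟩ := Finset.mem_image.1 h2
      simp only [Prod.mk.injEq] at h1 h2
      have h3 := hlt y hy
      have h4 := hlt z hz
      rw [h1.2, h1.1] at h3
      rw [h2.1, h2.2] at h4
      linarith
    have h1 := hsumE.sum_le_tsum ((G.image fun y => (y, π y)) ∪ (G.image fun y => (π y, y)))
      (fun p _ => hterm p)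
    rw [Finset.sum_union hdisj, Finset.sum_image i1, Finset.sum_image i2] at h1
    have h2 : ∑ y ∈ G, b (π y) y * (f (π y) - f y) * (f (π y) - f y) = ∑ y ∈ G, e y := by
      apply Finset.sum_congr rfl
      intro y _
      simp only [e]; rw [hsymm]; ring
    simp only at h1
    rw [h2] at h1
    unfold energyBilin
    have h3 : ∑ y ∈ G, e y = ∑ y ∈ G, b y (π y) * (f y - f (π y)) * (f y - f (π y)) := rfl
    linarith
  -- volume bound
  have hvol : ∀ (F : Finset X) (p : X), ∑ x ∈ F with root x = p, m x ≤ V := by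
    intro F p
    refine le_trans ?_ (le_ciSup hbddV p)
    have hfin := wg_finite_ball hb hs hc hbc hconn p r
    unfold vol
    rw [tsum_subtype {y | graphDist b p y ≤ r} m]
    have hsm : Summable (Set.indicator {y | graphDist b p y ≤ r} m) :=
      summable_of_hasFiniteSupport (hfin.subset (Set.support_indicator_subset))
    refine le_trans (le_of_eq ?_) (hsm.sum_le_tsum (F.filter fun x => root x = p)
      (fun x _ => Set.indicator_nonneg (fun x _ => (hm x).le) x))
    apply Finset.sum_congr rfl
    intro x hx
    rw [Set.indicator_of_mem]
    have := (Finset.mem_filter.1 hx).2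
    rw [← this]
    exact hrdist x
  have hEn : 0 ≤ energyBilin b f f := by
    simpa using hE ∅ (by simp)
  refine Real.tsum_le_of_sum_le (fun x => ?_) (fun F => ?_)
  · exact mul_nonneg (mul_self_nonneg _) (hm x).le
  let G := F.biUnion A
  have hG : ∀ y ∈ G, y ∉ D := by
    intro y hy
    obtain ⟨x, _, h⟩ := Finset.mem_biUnion.1 hy
    exact (hA x y h).1
  calc ∑ x ∈ F, f x * f x * m x
      ≤ ∑ x ∈ F, ∑ y ∈ G, (if root x = root y then r * (e y * m x) else 0) := by
        apply Finset.sum_le_sum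
        intro x hx
        have h1 : ∑ y ∈ A x, e y ≤ ∑ y ∈ G, (if root x = root y then e y else 0) := by
          rw [← Finset.sum_filter]
          apply Finset.sum_le_sum_of_subset_of_nonneg
          · intro y hy
            exact Finset.mem_filter.2 ⟨Finset.mem_biUnion.2 ⟨x, hx, hy⟩, (hA x y hy).2.1.symm⟩
          · intro y _ _; exact he0 y
        have h0 : 0 ≤ ∑ y ∈ A x, e y := Finset.sum_nonneg fun y _ => he0 y
        have h2 : f x ^ 2 ≤ r * ∑ y ∈ G, (if root x = root y then e y else 0) :=
          (hfA x).trans (mul_le_mul (hρr x) h1 h0 hr0)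
        calc f x * f x * m x = f x ^ 2 * m x := by ring
          _ ≤ (r * ∑ y ∈ G, (if root x = root y then e y else 0)) * m x :=
            mul_le_mul_of_nonneg_right h2 (hm x).le
          _ = _ := by
            rw [Finset.mul_sum, Finset.sum_mul]
            apply Finset.sum_congr rfl
            intro y _
            split_ifs <;> ring
    _ = ∑ y ∈ G, r * e y * ∑ x ∈ F with root x = root y, m x := by
        rw [Finset.sum_comm]
        apply Finset.sum_congr rfl
        intro y _
        rw [← Finset.sum_filter, Finset.mul_sum]
        apply Finset.sum_congr rfl
        intro x _; ring
    _ ≤ ∑ y ∈ G, r * e y * V := by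
        apply Finset.sum_le_sum
        intro y _
        exact mul_le_mul_of_nonneg_left (hvol F _) (mul_nonneg hr0 (he0 y))
    _ = r * V * ∑ y ∈ G, e y := by
        rw [Finset.mul_sum]
        apply Finset.sum_congr rfl
        intro y _; ring
    _ ≤ r * V * energyBilin b f f := mul_le_mul_of_nonneg_left (hE G hG) hpos.le

/-- Corollary 5.2. Let `(X,b,m)` be a connected weighted
graph satisfying (B) and (M), `D ⊆ X` relatively dense, `Ω := X∖D ≠ ∅`, and
`I ⊆ ℝ` an interval with `max I < 1/(Inr(Ω)·vol[Inr(Ω)])`. Then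
`P_I(H) 1_D P_I(H) ≥ κ P_I(H)` with
`κ = (1/(Inr(Ω)·vol[Inr(Ω)]) − max I)²/(16‖H+1‖⁴)`; equivalently (the form
stated here), `κ‖φ‖² ≤ ⟨1_D φ, φ⟩` for every `φ` in the range of
`P_I(H)`. -/
theorem statement_16 {X : Type*} [Countable X] [Nonempty X]
    (b : X → X → ℝ) (m : X → ℝ)
    (hb_symm : ∀ x y, b x y = b y x) (hb_nonneg : ∀ x y, 0 ≤ b x y)
    (hb_diag : ∀ x, b x x = 0) (hb_sum : ∀ x, Summable fun y => b x y)
    (hm_pos : ∀ x, 0 < m x)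
    (hconn : ∀ x y, ∃ γ, IsPathFrom b γ x y)
    (hB : BddAbove (Set.range fun x => (∑' y, b x y) / m x))
    (hM : BddAbove (Set.range m))
    (D : Set X) (hD : RelDense b D) (hΩne : (Dᶜ : Set X).Nonempty)
    -- the Hilbert space `𝓗 = ℓ²(X,m)`, realized via an isomorphism `J`
    -- onto the square-summable functions, carrying the `ℓ²(X,m)` inner product:
    {𝓗 : Type*} [NormedAddCommGroup 𝓗] [InnerProductSpace ℝ 𝓗] [CompleteSpace 𝓗]
    (J : 𝓗 →ₗ[ℝ] (X → ℝ))
    (hJ_inj : Function.Injective J)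
    (hJ_mem : ∀ u, MemL2 m (J u))
    (hJ_surj : ∀ f : X → ℝ, MemL2 m f → ∃ u, J u = f)
    (hJ_inner : ∀ u v : 𝓗, ⟪u, v⟫ = ∑' x, J u x * J v x * m x)
    -- the weighted Laplacian `H`, i.e. the bounded self-adjoint operator
    -- associated with the energy form:
    (H : 𝓗 →L[ℝ] 𝓗)
    (hH : ∀ u v : 𝓗, ⟪H u, v⟫ = energyBilin b (J u) (J v))
    -- the multiplication operator `1_D`:
    (W : 𝓗 →L[ℝ] 𝓗)
    (hW : ∀ u : 𝓗, J (W u) = D.indicator (J u))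
    -- the interval `I`, bounded above, with maximum `sSup I ∈ I`:
    (I : Set ℝ) (hI_ne : I.Nonempty) (hI_interval : I.OrdConnected)
    (hI_bdd : BddAbove I) (hI_max : sSup I ∈ I)
    (hI_max_lt : sSup I <
      1 / (inradius b Dᶜ * supVolBall b m (inradius b Dᶜ)))
    -- the spectral projection `P = P_I(H)`: an orthogonal projection such
    -- that `⟨Hφ,φ⟩ ≤ max I ‖φ‖²` on its range (as `I ⊆ (-∞, max I]`):
    (P : 𝓗 →L[ℝ] 𝓗)
    (hP_idem : P ∘L P = P)
    (hP_sa : ∀ u v : 𝓗, ⟪P u, v⟫ = ⟪u, P v⟫)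
    (hP_spec : ∀ u : 𝓗, ⟪H (P u), P u⟫ ≤ sSup I * ‖P u‖ ^ 2) :
    ∀ φ : 𝓗,
      ((1 / (inradius b Dᶜ * supVolBall b m (inradius b Dᶜ)) - sSup I) ^ 2 /
          (16 * ‖H + 1‖ ^ 4)) * ‖P φ‖ ^ 2 ≤ ⟪W (P φ), P φ⟫ := by
  intro φ
  classical
  set c := inradius b Dᶜ * supVolBall b m (inradius b Dᶜ) with hcdef
  set μ := sSup I with hμdef
  set u := P φ with hu
  have hspec : ⟪H u, u⟫ ≤ μ * ‖u‖ ^ 2 := hP_spec φ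
  have hpos : ∀ v : 𝓗, 0 ≤ ⟪H v, v⟫ := by
    intro v
    rw [hH]
    unfold energyBilin
    refine mul_nonneg (by norm_num) (tsum_nonneg fun p => ?_)
    rw [mul_assoc]; exact mul_nonneg (hb_nonneg _ _) (mul_self_nonneg _)
  have hsym : ∀ v w : 𝓗, ⟪H v, w⟫ = ⟪H w, v⟫ := by
    intro v w
    rw [hH, hH]
    unfold energyBilin
    congr 1
    apply tsum_congr
    intro p; ring
  have hnorm : ∀ v : 𝓗, ‖v‖ ^ 2 = ∑' x, J v x * J v x * m x := by
    intro v
    rw [← hJ_inner, real_inner_self_eq_norm_sq]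
  by_cases hu0 : u = 0
  · simp [hu0]
  have hun : 0 < ‖u‖ := norm_pos_iff.2 hu0
  have hμ0 : 0 ≤ μ := by
    by_contra h
    have h1 := hpos u
    have h2 : μ * ‖u‖ ^ 2 < 0 := mul_neg_of_neg_of_pos (not_le.1 h) (by positivity)
    linarith
  have hc : 0 < c := by
    have : 0 < 1 / c := lt_of_le_of_lt hμ0 hI_max_lt
    exact one_div_pos.1 this
  have hDne : D.Nonempty := by
    obtain ⟨R, _, hR⟩ := hD
    obtain ⟨p, hp, _⟩ := hR (Classical.arbitrary X)
    exact ⟨p, hp⟩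
  have hpoin : ∀ v : 𝓗, (∀ x ∈ D, J v x = 0) → 1 / c * ‖v‖ ^ 2 ≤ ⟪H v, v⟫ := by
    intro v hv
    have := wg_poincare hb_symm hb_nonneg hb_sum hm_pos hconn hB hM D hDne hc (hJ_mem v) hv
    rw [← hnorm, ← hH, ← hcdef] at this
    rw [one_div, inv_mul_le_iff₀ hc]
    exact this
  set lam := 1 / c with hlam
  have hHle : ∀ v w : 𝓗, |⟪H v, w⟫| ≤ ‖H‖ * ‖v‖ * ‖w‖ := by
    intro v w
    refine (abs_real_inner_le_norm _ _).trans ?_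
    exact mul_le_mul_of_nonneg_right (H.le_opNorm v) (norm_nonneg _)
  have hlamH : lam ≤ ‖H‖ := by
    obtain ⟨x0, hx0⟩ := hΩne
    obtain ⟨v, hv⟩ := hJ_surj (Pi.single x0 1) (by
      refine summable_of_hasFiniteSupport ((Set.finite_singleton x0).subset ?_)
      intro x hx
      by_contra h
      have h' : x ≠ x0 := h
      simp [h'] at hx)
    have hvne : v ≠ 0 := by
      rintro rfl
      rw [map_zero] at hv
      have := congrFun hv x0
      simp at this
    have hvn : 0 < ‖v‖ := norm_pos_iff.2 hvne
    have h1 := hpoin v (by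
      intro x hx
      have : x ≠ x0 := by rintro rfl; exact hx0 hx
      rw [hv]; simp [this])
    have h2 := (le_abs_self _).trans (hHle v v)
    have h3 : lam * ‖v‖ ^ 2 ≤ ‖H‖ * ‖v‖ ^ 2 := by
      calc _ ≤ _ := h1
        _ ≤ _ := h2
        _ = _ := by ring
    exact le_of_mul_le_mul_right h3 (by positivity)
  have hexp : ∀ v : 𝓗, ‖(H + 1) v‖ ^ 2 = ‖H v‖ ^ 2 + 2 * ⟪H v, v⟫ + ‖v‖ ^ 2 := by
    intro v
    have : (H + 1) v = H v + v := rfl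
    rw [this, norm_add_sq_real]
  set N := ‖H + 1‖ with hN
  have hN1 : 1 ≤ N := by
    have h1 := hexp u
    have h2 := (H + 1).le_opNorm u
    have h3 : ‖u‖ ≤ ‖(H + 1) u‖ := by
      apply le_of_sq_le_sq _ (norm_nonneg _)
      nlinarith [hpos u, sq_nonneg ‖H u‖]
    have h4 : 1 * ‖u‖ ≤ N * ‖u‖ := by linarith
    exact le_of_mul_le_mul_right h4 hun
  have hHN : ‖H‖ ≤ N := by
    apply ContinuousLinearMap.opNorm_le_bound _ (norm_nonneg _)
    intro v
    refine le_trans ?_ ((H + 1).le_opNorm v)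
    apply le_of_sq_le_sq _ (norm_nonneg _)
    nlinarith [hpos v, sq_nonneg ‖v‖, hexp v]
  set w := W u with hw
  set v := u - w with hv
  have hJw : J w = D.indicator (J u) := hW u
  have hwu : ⟪w, u⟫ = ‖w‖ ^ 2 := by
    rw [hnorm, hJ_inner, hJw]
    apply tsum_congr
    intro x
    by_cases hx : x ∈ D <;> simp [hx]
  have hvn : ‖v‖ ^ 2 = ‖u‖ ^ 2 - ‖w‖ ^ 2 := by
    rw [hv, norm_sub_sq_real, real_inner_comm, hwu]; ring
  have hEv := hpoin v (by
    intro x hx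
    rw [hv, map_sub, Pi.sub_apply, hJw]
    simp [hx])
  rw [hwu]
  have huvw : u = v + w := by rw [hv]; abel
  have hdec : ⟪H u, u⟫ = ⟪H v, v⟫ + 2 * ⟪H v, w⟫ + ⟪H w, w⟫ := by
    rw [huvw, map_add, inner_add_left, inner_add_right, inner_add_right, hsym w v]; ring
  have hvw := (abs_le.1 (hHle v w)).1
  have hw0 := norm_nonneg w
  have hv0 := norm_nonneg v
  have hH0 := norm_nonneg H
  have hvu : ‖v‖ ≤ ‖u‖ := by
    apply le_of_sq_le_sq _ hun.le
    nlinarith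
  have hwu' : ‖w‖ ≤ ‖u‖ := by
    apply le_of_sq_le_sq _ hun.le
    nlinarith
  have hlam0 : 0 < lam := one_div_pos.2 hc
  have hk : (lam - μ) * ‖u‖ ^ 2 ≤ 3 * ‖H‖ * ‖w‖ * ‖u‖ := by
    have a1 : lam * ‖w‖ ^ 2 ≤ ‖H‖ * (‖w‖ * ‖u‖) := by
      apply mul_le_mul hlamH _ (by positivity) hH0
      rw [sq]; exact mul_le_mul_of_nonneg_left hwu' hw0
    have a2 : ‖H‖ * ‖v‖ * ‖w‖ ≤ ‖H‖ * ‖u‖ * ‖w‖ :=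
      mul_le_mul_of_nonneg_right (mul_le_mul_of_nonneg_left hvu hH0) hw0
    have a3 := hpos w
    rw [hvn] at hEv
    linarith
  have hk2 : (lam - μ) * ‖u‖ ≤ 4 * N ^ 2 * ‖w‖ := by
    have a1 : (lam - μ) * ‖u‖ ≤ 3 * ‖H‖ * ‖w‖ := by
      refine le_of_mul_le_mul_right ?_ hun
      calc _ = (lam - μ) * ‖u‖ ^ 2 := by ring
        _ ≤ _ := hk
    refine a1.trans (mul_le_mul_of_nonneg_right ?_ hw0)
    nlinarith
  have hgap : 0 ≤ lam - μ := by linarith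
  have hsq : ((lam - μ) * ‖u‖) ^ 2 ≤ (4 * N ^ 2 * ‖w‖) ^ 2 :=
    pow_le_pow_left₀ (by positivity) hk2 2
  have hN4 : 0 < 16 * N ^ 4 := by positivity
  rw [div_mul_eq_mul_div, div_le_iff₀ hN4]
  nlinarith
end
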